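/- arXiv:2507.14978 — 9 statements merged into one kernel-verified Lean document; each statement's English description precedes it below -/
import Mathlib

section
/- Let p, q : ℝ → ℂ be smooth and let m₁, m₂, m₃, n₁, n₂, n₃ ∈ ℂ. Then the operators L and M commute (L∘M = M∘L as operators on smooth functions) if and only if equations (E1) and (E2) hold identically on ℝ; and L and N commute if and only if equations (E3) and (E4) hold identically on ℝ. -/
/-- The third-order operator `L = D³ + pD + q`. -/
noncomputable def Lop (p q : ℝ → ℂ) (f : ℝ → ℂ) : ℝ → ℂ :=
  fun x => iteratedDeriv 3 f x + p x * deriv f x + q x * f x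

/-- The fourth-order operator `M`. -/
noncomputable def Mop (p q : ℝ → ℂ) (m₁ m₂ m₃ : ℂ) (f : ℝ → ℂ) : ℝ → ℂ :=
  fun x => iteratedDeriv 4 f x
    + ((4 / 3) * p x + m₁) * iteratedDeriv 2 f x
    + ((2 / 3) * deriv p x + (4 / 3) * q x + m₂) * deriv f x
    + ((2 / 9) * iteratedDeriv 2 p x + (2 / 3) * deriv q x + (2 / 9) * (p x) ^ 2
        + (2 / 3) * m₁ * p x + m₃) * f x

/-- The fifth-order operator `N`. -/
noncomputable def Nop (p q : ℝ → ℂ) (n₁ n₂ n₃ : ℂ) (f : ℝ → ℂ) : ℝ → ℂ :=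
  fun x => iteratedDeriv 5 f x
    + (5 / 3) * p x * iteratedDeriv 3 f x
    + ((5 / 3) * deriv p x + (5 / 3) * q x + n₁) * iteratedDeriv 2 f x
    + ((10 / 9) * iteratedDeriv 2 p x + (5 / 3) * deriv q x + (5 / 9) * (p x) ^ 2
        + n₂) * deriv f x
    + ((10 / 9) * iteratedDeriv 2 q x + (10 / 9) * p x * q x + (2 / 3) * n₁ * p x
        + n₃) * f x

/-- Novikov equation (E1): `(m₂p + 2m₁u + (4/3)pu + (2/3)u'')' = 0`. -/
def NovikovE1 (m₁ m₂ : ℂ) (p u : ℝ → ℂ) : Prop :=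
  ∀ x : ℝ, deriv (fun y => m₂ * p y + 2 * m₁ * u y + (4 / 3) * (p y * u y)
    + (2 / 3) * iteratedDeriv 2 u y) x = 0

/-- Novikov equation (E2). -/
def NovikovE2 (m₁ m₂ : ℂ) (p u : ℝ → ℂ) : Prop :=
  ∀ x : ℝ, deriv (fun y =>
    -(1 / 3) * m₁ * (p y) ^ 2 + m₂ * u y + (1 / 2) * m₂ * deriv p y
      + m₁ * deriv u y - (1 / 6) * m₁ * iteratedDeriv 2 p y
      + (2 / 3) * (u y) ^ 2 - (4 / 27) * (p y) ^ 3
      + (2 / 3) * (p y * deriv u y) + (2 / 3) * (deriv p y * u y)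
      - (1 / 6) * (deriv p y) ^ 2 - (1 / 3) * (p y * iteratedDeriv 2 p y)
      + (1 / 3) * iteratedDeriv 3 u y - (1 / 18) * iteratedDeriv 4 p y) x = 0

/-- Novikov equation (E3). -/
def NovikovE3 (n₁ n₂ : ℂ) (p u : ℝ → ℂ) : Prop :=
  ∀ x : ℝ, deriv (fun y =>
    n₂ * p y + 2 * n₁ * u y - (5 / 27) * (p y) ^ 3 + (5 / 3) * (u y) ^ 2
      - (5 / 12) * (deriv p y) ^ 2 - (5 / 9) * (p y * iteratedDeriv 2 p y)
      - (1 / 9) * iteratedDeriv 4 p y) x = 0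

/-- Novikov equation (E4). -/
def NovikovE4 (n₁ n₂ : ℂ) (p u : ℝ → ℂ) : Prop :=
  ∀ x : ℝ, deriv (fun y =>
    -(1 / 3) * n₁ * (p y) ^ 2 + n₂ * u y + (1 / 2) * n₂ * deriv p y
      + n₁ * deriv u y - (1 / 6) * n₁ * iteratedDeriv 2 p y
      - (5 / 9) * ((p y) ^ 2 * u y) - (5 / 18) * ((p y) ^ 2 * deriv p y)
      + (5 / 3) * (u y * deriv u y) - (5 / 18) * (deriv p y * deriv u y)
      - (5 / 18) * (iteratedDeriv 2 p y * u y)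
      - (25 / 36) * (deriv p y * iteratedDeriv 2 p y)
      - (5 / 9) * (p y * iteratedDeriv 2 u y)
      - (5 / 18) * (p y * iteratedDeriv 3 p y)
      - (1 / 9) * iteratedDeriv 4 u y - (1 / 18) * iteratedDeriv 5 p y) x = 0

open scoped ContDiff

/-- The algebra of smooth functions `ℝ → ℂ`. -/
def smoothSubalgebra : Subalgebra ℂ (ℝ → ℂ) where
  carrier := {f | ContDiff ℝ ∞ f}
  mul_mem' {f g} (hf : ContDiff ℝ ∞ f) (hg : ContDiff ℝ ∞ g) := hf.mul hg
  add_mem' {f g} (hf : ContDiff ℝ ∞ f) (hg : ContDiff ℝ ∞ g) := hf.add hg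
  algebraMap_mem' c := (contDiff_const : ContDiff ℝ ∞ fun _ : ℝ => c)

namespace smoothSubalgebra

lemma contDiff_coe (f : smoothSubalgebra) : ContDiff ℝ ∞ (f : ℝ → ℂ) := f.2

lemma differentiableAt_coe (f : smoothSubalgebra) (x : ℝ) :
    DifferentiableAt ℝ (f : ℝ → ℂ) x :=
  (contDiff_coe f).differentiable (by simp) x

/-- Differentiation, as a derivation of the algebra of smooth functions. -/
noncomputable def D : Derivation ℂ smoothSubalgebra smoothSubalgebra :=
  Derivation.mk'
    { toFun := fun f => ⟨deriv f, (contDiff_infty_iff_deriv.mp (contDiff_coe f)).2⟩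
      map_add' := fun f g => Subtype.ext <| funext fun x =>
        deriv_add (differentiableAt_coe f x) (differentiableAt_coe g x)
      map_smul' := fun c f => Subtype.ext <| funext fun x =>
        deriv_const_smul c (differentiableAt_coe f x) }
    fun f g => Subtype.ext <| funext fun x =>
      (deriv_mul (differentiableAt_coe f x) (differentiableAt_coe g x)).trans <| by
        simp [mul_comm, add_comm]

lemma deriv_coe (f : smoothSubalgebra) : deriv (f : ℝ → ℂ) = D f := rfl

lemma iteratedDeriv_coe (n : ℕ) (f : smoothSubalgebra) :
    iteratedDeriv n (f : ℝ → ℂ) = (D^[n] f : smoothSubalgebra) := by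
  induction n with
  | zero => simp
  | succ n ih => rw [iteratedDeriv_succ, ih, deriv_coe, Function.iterate_succ_apply']

lemma D_mul (f g : smoothSubalgebra) : D (f * g) = f * D g + g * D f := D.leibniz f g

lemma D_smul (c : ℂ) (f : smoothSubalgebra) : D (c • f) = c • D f := D.map_smul c f

lemma coe_mul_apply (f g : smoothSubalgebra) (x : ℝ) :
    ((f * g : smoothSubalgebra) : ℝ → ℂ) x = (f : ℝ → ℂ) x * (g : ℝ → ℂ) x := rfl

lemma coe_add_apply (f g : smoothSubalgebra) (x : ℝ) :
    ((f + g : smoothSubalgebra) : ℝ → ℂ) x = (f : ℝ → ℂ) x + (g : ℝ → ℂ) x := rfl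

lemma coe_sub_apply (f g : smoothSubalgebra) (x : ℝ) :
    ((f - g : smoothSubalgebra) : ℝ → ℂ) x = (f : ℝ → ℂ) x - (g : ℝ → ℂ) x := rfl

lemma coe_smul_apply (c : ℂ) (f : smoothSubalgebra) (x : ℝ) :
    ((c • f : smoothSubalgebra) : ℝ → ℂ) x = c * (f : ℝ → ℂ) x := rfl

lemma coe_neg_apply (f : smoothSubalgebra) (x : ℝ) :
    ((-f : smoothSubalgebra) : ℝ → ℂ) x = -(f : ℝ → ℂ) x := rfl

/-- The operator `Lop` on smooth functions. -/
noncomputable def L (p q f : smoothSubalgebra) : smoothSubalgebra :=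
  D (D (D f)) + p * D f + q * f

/-- The operator `Mop` on smooth functions. -/
noncomputable def M (p q : smoothSubalgebra) (m₁ m₂ m₃ : ℂ) (f : smoothSubalgebra) :
    smoothSubalgebra :=
  D (D (D (D f))) + ((4 / 3 : ℂ) • (p * D (D f)) + m₁ • D (D f))
    + ((2 / 3 : ℂ) • (D p * D f) + (4 / 3 : ℂ) • (q * D f) + m₂ • D f)
    + ((2 / 9 : ℂ) • (D (D p) * f) + (2 / 3 : ℂ) • (D q * f) + (2 / 9 : ℂ) • (p * p * f)
      + (2 / 3 * m₁) • (p * f) + m₃ • f)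

/-- The operator `Nop` on smooth functions. -/
noncomputable def N (p q : smoothSubalgebra) (n₁ n₂ n₃ : ℂ) (f : smoothSubalgebra) :
    smoothSubalgebra :=
  D (D (D (D (D f)))) + (5 / 3 : ℂ) • (p * D (D (D f)))
    + ((5 / 3 : ℂ) • (D p * D (D f)) + (5 / 3 : ℂ) • (q * D (D f)) + n₁ • D (D f))
    + ((10 / 9 : ℂ) • (D (D p) * D f) + (5 / 3 : ℂ) • (D q * D f)
      + (5 / 9 : ℂ) • (p * p * D f) + n₂ • D f)
    + ((10 / 9 : ℂ) • (D (D q) * f) + (10 / 9 : ℂ) • (p * q * f)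
      + (2 / 3 * n₁) • (p * f) + n₃ • f)

lemma Lop_coe (p q f : smoothSubalgebra) : Lop p q f = L p q f := by
  funext x
  simp [Lop, L, iteratedDeriv_coe, deriv_coe]

lemma Mop_coe (p q : smoothSubalgebra) (m₁ m₂ m₃ : ℂ) (f : smoothSubalgebra) :
    Mop p q m₁ m₂ m₃ f = M p q m₁ m₂ m₃ f := by
  funext x
  simp [Mop, M, iteratedDeriv_coe, deriv_coe]
  ring

lemma Nop_coe (p q : smoothSubalgebra) (n₁ n₂ n₃ : ℂ) (f : smoothSubalgebra) :
    Nop p q n₁ n₂ n₃ f = N p q n₁ n₂ n₃ f := by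
  funext x
  simp [Nop, N, iteratedDeriv_coe, deriv_coe]
  ring

/-- The quantity whose derivative vanishes in `NovikovE1`. -/
noncomputable def E1 (m₁ m₂ : ℂ) (p u : smoothSubalgebra) : smoothSubalgebra :=
  m₂ • p + (2 * m₁) • u + (4 / 3 : ℂ) • (p * u) + (2 / 3 : ℂ) • D (D u)

/-- The quantity whose derivative vanishes in `NovikovE2`. -/
noncomputable def E2 (m₁ m₂ : ℂ) (p u : smoothSubalgebra) : smoothSubalgebra :=
  (-(1 / 3) * m₁) • (p * p) + m₂ • u + (1 / 2 * m₂) • D p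
    + m₁ • D u - (1 / 6 * m₁) • D (D p)
    + (2 / 3 : ℂ) • (u * u) - (4 / 27 : ℂ) • (p * p * p)
    + (2 / 3 : ℂ) • (p * D u) + (2 / 3 : ℂ) • (D p * u)
    - (1 / 6 : ℂ) • (D p * D p) - (1 / 3 : ℂ) • (p * D (D p))
    + (1 / 3 : ℂ) • D (D (D u)) - (1 / 18 : ℂ) • D (D (D (D p)))

/-- The quantity whose derivative vanishes in `NovikovE3`. -/
noncomputable def E3 (n₁ n₂ : ℂ) (p u : smoothSubalgebra) : smoothSubalgebra :=
  n₂ • p + (2 * n₁) • u - (5 / 27 : ℂ) • (p * p * p) + (5 / 3 : ℂ) • (u * u)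
    - (5 / 12 : ℂ) • (D p * D p) - (5 / 9 : ℂ) • (p * D (D p))
    - (1 / 9 : ℂ) • D (D (D (D p)))

/-- The quantity whose derivative vanishes in `NovikovE4`. -/
noncomputable def E4 (n₁ n₂ : ℂ) (p u : smoothSubalgebra) : smoothSubalgebra :=
  (-(1 / 3) * n₁) • (p * p) + n₂ • u + (1 / 2 * n₂) • D p
    + n₁ • D u - (1 / 6 * n₁) • D (D p)
    - (5 / 9 : ℂ) • (p * p * u) - (5 / 18 : ℂ) • (p * p * D p)
    + (5 / 3 : ℂ) • (u * D u) - (5 / 18 : ℂ) • (D p * D u)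
    - (5 / 18 : ℂ) • (D (D p) * u)
    - (25 / 36 : ℂ) • (D p * D (D p))
    - (5 / 9 : ℂ) • (p * D (D u))
    - (5 / 18 : ℂ) • (p * D (D (D p)))
    - (1 / 9 : ℂ) • D (D (D (D u))) - (1 / 18 : ℂ) • D (D (D (D (D p))))

lemma forall_deriv_eq_zero_iff {g : ℝ → ℂ} {h : smoothSubalgebra} (hgh : g = h) :
    (∀ x, deriv g x = 0) ↔ D h = 0 := by
  subst hgh
  rw [deriv_coe, Subtype.ext_iff, funext_iff]
  rfl

lemma novikovE1_coe (m₁ m₂ : ℂ) (p u : smoothSubalgebra) :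
    NovikovE1 m₁ m₂ p u ↔ D (E1 m₁ m₂ p u) = 0 := by
  refine forall_deriv_eq_zero_iff (funext fun x => ?_)
  simp [E1, iteratedDeriv_coe]

lemma novikovE2_coe (m₁ m₂ : ℂ) (p u : smoothSubalgebra) :
    NovikovE2 m₁ m₂ p u ↔ D (E2 m₁ m₂ p u) = 0 := by
  refine forall_deriv_eq_zero_iff (funext fun x => ?_)
  simp [E2, iteratedDeriv_coe, deriv_coe]
  ring

lemma novikovE3_coe (n₁ n₂ : ℂ) (p u : smoothSubalgebra) :
    NovikovE3 n₁ n₂ p u ↔ D (E3 n₁ n₂ p u) = 0 := by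
  refine forall_deriv_eq_zero_iff (funext fun x => ?_)
  simp [E3, iteratedDeriv_coe, deriv_coe]
  ring

lemma novikovE4_coe (n₁ n₂ : ℂ) (p u : smoothSubalgebra) :
    NovikovE4 n₁ n₂ p u ↔ D (E4 n₁ n₂ p u) = 0 := by
  refine forall_deriv_eq_zero_iff (funext fun x => ?_)
  simp [E4, iteratedDeriv_coe, deriv_coe]
  ring

lemma L_M_sub_M_L (p q : smoothSubalgebra) (m₁ m₂ m₃ : ℂ) (f : smoothSubalgebra) :
    L p q (M p q m₁ m₂ m₃ f) - M p q m₁ m₂ m₃ (L p q f)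
      = -(D (E1 m₁ m₂ p (q - (1 / 2 : ℂ) • D p)) * D f
        + D (E2 m₁ m₂ p (q - (1 / 2 : ℂ) • D p)) * f) := by
  refine Subtype.ext <| funext fun x => ?_
  simp only [L, M, E1, E2, map_add, map_sub, D_smul, D_mul, coe_mul_apply, coe_add_apply,
    coe_sub_apply, coe_smul_apply, coe_neg_apply]
  ring

lemma L_N_sub_N_L (p q : smoothSubalgebra) (n₁ n₂ n₃ : ℂ) (f : smoothSubalgebra) :
    L p q (N p q n₁ n₂ n₃ f) - N p q n₁ n₂ n₃ (L p q f)
      = -(D (E3 n₁ n₂ p (q - (1 / 2 : ℂ) • D p)) * D f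
        + D (E4 n₁ n₂ p (q - (1 / 2 : ℂ) • D p)) * f) := by
  refine Subtype.ext <| funext fun x => ?_
  simp only [L, N, E3, E4, map_add, map_sub, D_smul, D_mul, coe_mul_apply, coe_add_apply,
    coe_sub_apply, coe_smul_apply, coe_neg_apply]
  ring

/-- A first-order differential operator vanishes iff its coefficients do. -/
lemma forall_mul_D_add_mul_eq_zero_iff (a b : smoothSubalgebra) :
    (∀ f, a * D f + b * f = 0) ↔ a = 0 ∧ b = 0 := by
  refine ⟨fun h => ?_, fun ⟨ha, hb⟩ f => by simp [ha, hb]⟩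
  have hb : b = 0 := by simpa using h 1
  let X : smoothSubalgebra := ⟨fun x => (x : ℂ),
    (Complex.ofRealCLM.contDiff : ContDiff ℝ ∞ Complex.ofRealCLM)⟩
  have hX : D X = 1 :=
    Subtype.ext <| funext fun x =>
      (Complex.ofRealCLM.hasDerivAt (x := x)).deriv.trans Complex.ofReal_one
  exact ⟨by simpa [hb, hX] using h X, hb⟩

lemma forall_contDiff_comm_iff {A B : (ℝ → ℂ) → ℝ → ℂ}
    {A' B' : smoothSubalgebra → smoothSubalgebra} {a b : smoothSubalgebra}
    (hA : ∀ f : smoothSubalgebra, A f = A' f) (hB : ∀ f : smoothSubalgebra, B f = B' f)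
    (h : ∀ f, A' (B' f) - B' (A' f) = -(a * D f + b * f)) :
    (∀ f : ℝ → ℂ, ContDiff ℝ ∞ f → ∀ x : ℝ, A (B f) x = B (A f) x) ↔ a = 0 ∧ b = 0 := by
  rw [← forall_mul_D_add_mul_eq_zero_iff]
  refine (Subtype.forall (p := fun f => f ∈ smoothSubalgebra)
    (q := fun f => ∀ x, A (B f) x = B (A f) x)).symm.trans (forall_congr' fun f => ?_)
  rw [← funext_iff, hA, hB, hA, hB, ← Subtype.ext_iff, ← sub_eq_zero, h, neg_eq_zero]

end smoothSubalgebra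

/-- `L` commutes with `M` (as operators on smooth functions) iff (E1),(E2)
hold identically, and `L` commutes with `N` iff (E3),(E4) hold identically,
where `u = q − p'/2`. -/
theorem stmt_0 (p q : ℝ → ℂ) (hp : ContDiff ℝ (⊤ : ℕ∞) p)
    (hq : ContDiff ℝ (⊤ : ℕ∞) q) (m₁ m₂ m₃ n₁ n₂ n₃ : ℂ) :
    let u : ℝ → ℂ := fun x => q x - deriv p x / 2
    ((∀ f : ℝ → ℂ, ContDiff ℝ (⊤ : ℕ∞) f →
        ∀ x : ℝ, Lop p q (Mop p q m₁ m₂ m₃ f) x = Mop p q m₁ m₂ m₃ (Lop p q f) x)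
      ↔ (NovikovE1 m₁ m₂ p u ∧ NovikovE2 m₁ m₂ p u))
    ∧
    ((∀ f : ℝ → ℂ, ContDiff ℝ (⊤ : ℕ∞) f →
        ∀ x : ℝ, Lop p q (Nop p q n₁ n₂ n₃ f) x = Nop p q n₁ n₂ n₃ (Lop p q f) x)
      ↔ (NovikovE3 n₁ n₂ p u ∧ NovikovE4 n₁ n₂ p u)) := by
  lift p to smoothSubalgebra using hp
  lift q to smoothSubalgebra using hq
  intro u
  have hu : u = (q - (1 / 2 : ℂ) • smoothSubalgebra.D p : smoothSubalgebra) := by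
    funext x
    simp [u, smoothSubalgebra.deriv_coe]
    ring
  rw [hu, smoothSubalgebra.novikovE1_coe, smoothSubalgebra.novikovE2_coe,
    smoothSubalgebra.novikovE3_coe, smoothSubalgebra.novikovE4_coe]
  exact ⟨smoothSubalgebra.forall_contDiff_comm_iff (smoothSubalgebra.Lop_coe p q)
      (smoothSubalgebra.Mop_coe p q m₁ m₂ m₃) (smoothSubalgebra.L_M_sub_M_L p q m₁ m₂ m₃),
    smoothSubalgebra.forall_contDiff_comm_iff (smoothSubalgebra.Lop_coe p q)
      (smoothSubalgebra.Nop_coe p q n₁ n₂ n₃) (smoothSubalgebra.L_N_sub_N_L p q n₁ n₂ n₃)⟩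
end

section
/- Let t₁, t₂ ∈ ℝ and let P be a smooth, everywhere positive real function on an interval satisfying P'' = 3(P')²/(4P) − P² + t₁P + t₂. Then the function x ↦ P(x)^{−3/2}·((P'(x))² + (4/3)P(x)³ − 4t₁P(x)² + 4t₂P(x)) is constant on the interval. -/
/-- For the genus-2 system with `U ≡ 0`, the quantity
`P^{−3/2}·((P')² + (4/3)P³ − 4t₁P² + 4t₂P)` is a first integral of the
resulting second-order ODE `P'' = 3(P')²/(4P) − P² + t₁P + t₂`. -/
theorem stmt_4 (t₁ t₂ : ℝ) (a b : ℝ) (P : ℝ → ℝ)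
    (hP : ContDiffOn ℝ (⊤ : ℕ∞) P (Set.Ioo a b))
    (hPpos : ∀ x ∈ Set.Ioo a b, 0 < P x)
    (hode : ∀ x ∈ Set.Ioo a b, iteratedDeriv 2 P x =
      3 * (deriv P x) ^ 2 / (4 * P x) - (P x) ^ 2 + t₁ * P x + t₂) :
    ∃ c : ℝ, ∀ x ∈ Set.Ioo a b,
      P x ^ (-(3 : ℝ) / 2) * ((deriv P x) ^ 2 + (4 / 3) * (P x) ^ 3
        - 4 * t₁ * (P x) ^ 2 + 4 * t₂ * P x) = c := by
  have hderiv : ∀ x ∈ Set.Ioo a b, HasDerivAt (fun y => P y ^ (-(3 : ℝ) / 2) *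
      ((deriv P y) ^ 2 + (4 / 3) * (P y) ^ 3 - 4 * t₁ * (P y) ^ 2 + 4 * t₂ * P y)) 0 x := by
    intro x hx
    have hpos := hPpos x hx
    have hne := hpos.ne'
    have hP₁ : HasDerivAt P (deriv P x) x :=
      ((hP.differentiableOn (by simp)).differentiableAt (isOpen_Ioo.mem_nhds hx)).hasDerivAt
    have hP₂ : HasDerivAt (deriv P) (iteratedDeriv 2 P x) x := by
      have hsmooth : ContDiffOn ℝ 1 (deriv P) (Set.Ioo a b) :=
        hP.deriv_of_isOpen isOpen_Ioo (WithTop.coe_le_coe.2 (le_top : (1 + 1 : ℕ∞) ≤ ⊤))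
      rw [iteratedDeriv_succ, iteratedDeriv_one]
      exact ((hsmooth.differentiableOn (by simp)).differentiableAt
        (isOpen_Ioo.mem_nhds hx)).hasDerivAt
    rw [hode x hx] at hP₂
    have hpow : P x ^ (-(3 : ℝ) / 2 - 1) = P x ^ (-(3 : ℝ) / 2) / P x :=
      Real.rpow_sub_one hne _
    have hQ := (((hP₂.pow 2).add ((hP₁.pow 3).const_mul (4 / 3))).sub
      ((hP₁.pow 2).const_mul (4 * t₁))).add (hP₁.const_mul (4 * t₂))
    refine ((hP₁.rpow_const (p := -(3 : ℝ) / 2) (Or.inl hne)).mul hQ).congr_deriv ?_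
    simp only [hpow, Pi.add_apply, Pi.sub_apply, Pi.pow_apply]
    field_simp
    push_cast
    ring
  obtain ⟨c, hc⟩ := isOpen_Ioo.exists_is_const_of_deriv_eq_zero isPreconnected_Ioo
    (fun x hx => (hderiv x hx).differentiableAt.differentiableWithinAt)
    (fun x hx => (hderiv x hx).deriv)
  exact ⟨c, hc⟩
end

section
/- Let t₁, t₂, t₃ ∈ ℝ and let P, U be smooth real functions on an interval with P' nowhere zero, satisfying the genus-1 dynamical system and the surface constraint identically. Then the function U'/P' is constant on the interval. -/
/-- Functions agreeing on an open set have the same derivative at each of its points. -/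
theorem HasDerivAt.eq_of_eqOn_isOpen {f g : ℝ → ℝ} {f' g' x : ℝ} {s : Set ℝ}
    (hs : IsOpen s) (hx : x ∈ s) (hfg : Set.EqOn f g s)
    (hf : HasDerivAt f f' x) (hg : HasDerivAt g g' x) : f' = g' :=
  (hf.congr_of_eventuallyEq
    ((hfg.eventuallyEq_of_mem (hs.mem_nhds hx)).symm)).unique hg


/-- Along solutions of the genus-1 dynamical system satisfying the surface
constraint, the ratio `U'/P'` is a constant. -/
theorem stmt_5 (t₁ t₂ t₃ : ℝ) (a b : ℝ) (P U : ℝ → ℝ)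
    (hP : ContDiffOn ℝ (⊤ : ℕ∞) P (Set.Ioo a b))
    (hU : ContDiffOn ℝ (⊤ : ℕ∞) U (Set.Ioo a b))
    (hP'ne : ∀ x ∈ Set.Ioo a b, deriv P x ≠ 0)
    (hsysP : ∀ x ∈ Set.Ioo a b, iteratedDeriv 2 P x =
      -2 * t₂ + 4 * t₁ * P x - 2 * (P x) ^ 2
        + 12 * U x * deriv U x / deriv P x
        - 24 * P x * (deriv U x) ^ 2 / (deriv P x) ^ 2)
    (hsysU : ∀ x ∈ Set.Ioo a b, iteratedDeriv 2 U x =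
      t₃ * P x - (4 / 3) * P x * U x - 2 * t₂ * deriv U x / deriv P x
        + 2 * t₁ * P x * deriv U x / deriv P x
        - (2 / 3) * (P x) ^ 2 * deriv U x / deriv P x
        - 12 * U x * (deriv U x) ^ 2 / (deriv P x) ^ 2
        - 16 * P x * (deriv U x) ^ 3 / (deriv P x) ^ 3)
    (hsurf : ∀ x ∈ Set.Ioo a b,
      3 * t₃ * (deriv P x) ^ 3 - 4 * U x * (deriv P x) ^ 3
        - 6 * t₁ * (deriv P x) ^ 2 * deriv U x
        + 4 * P x * (deriv P x) ^ 2 * deriv U x + 24 * (deriv U x) ^ 3 = 0) :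
    ∃ c : ℝ, ∀ x ∈ Set.Ioo a b, deriv U x / deriv P x = c := by
  have hI : IsOpen (Set.Ioo a b) := isOpen_Ioo
  have smooth_deriv : ∀ f : ℝ → ℝ, ContDiffOn ℝ (⊤ : ℕ∞) f (Set.Ioo a b) →
      ContDiffOn ℝ (⊤ : ℕ∞) (deriv f) (Set.Ioo a b) := fun f hf =>
    hf.deriv_of_isOpen hI (by norm_num)
  have has : ∀ f : ℝ → ℝ, ContDiffOn ℝ (⊤ : ℕ∞) f (Set.Ioo a b) →
      ∀ x ∈ Set.Ioo a b, HasDerivAt f (deriv f x) x := fun f hf x hx =>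
    ((hf.differentiableOn (by norm_num)).differentiableAt (hI.mem_nhds hx)).hasDerivAt
  obtain ⟨m, hm_def⟩ : ∃ m : ℝ → ℝ, m = fun x => deriv U x / deriv P x := ⟨_, rfl⟩
  have hm : ContDiffOn ℝ (⊤ : ℕ∞) m (Set.Ioo a b) := by
    rw [hm_def]
    exact (smooth_deriv U hU).div (smooth_deriv P hP) hP'ne
  have hm' := smooth_deriv m hm
  have hUm : ∀ x ∈ Set.Ioo a b, deriv U x = m x * deriv P x := by
    intro x hx
    rw [hm_def]
    field_simp [hP'ne x hx]
  have hS : ∀ x ∈ Set.Ioo a b,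
      3 * t₃ - 4 * U x - 6 * t₁ * m x + 4 * P x * m x + 24 * m x ^ 3 = 0 := by
    intro x hx
    have h := hsurf x hx
    rw [hUm x hx] at h
    apply (mul_eq_zero.mp (?_ : deriv P x ^ 3 * _ = 0)).resolve_left
      (pow_ne_zero 3 (hP'ne x hx))
    linear_combination h
  have hS' : ∀ x ∈ Set.Ioo a b, deriv m x * (4 * P x - 6 * t₁ + 72 * m x ^ 2) = 0 := by
    intro x hx
    have hd := (((((hasDerivAt_const x (3 * t₃)).sub ((has U hU x hx).const_mul 4)).sub
      ((has m hm x hx).const_mul (6 * t₁))).add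
      (((has P hP x hx).const_mul 4).mul (has m hm x hx))).add
      (((has m hm x hx).pow 3).const_mul 24))
    have h := HasDerivAt.eq_of_eqOn_isOpen (g := fun _ => 0) hI hx
      (fun y hy => by simpa using hS y hy) hd (hasDerivAt_const x 0)
    rw [hUm x hx] at h
    norm_num at h
    linear_combination h
  have hP2 : ∀ x ∈ Set.Ioo a b, deriv (deriv P) x =
      -2 * t₂ + 4 * t₁ * P x - 2 * P x ^ 2 + 12 * U x * m x - 24 * P x * m x ^ 2 := by
    intro x hx
    have h := hsysP x hx
    rw [iteratedDeriv_succ, iteratedDeriv_one, hUm x hx] at h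
    have := hP'ne x hx
    rw [h]
    field_simp
  have hU2 : ∀ x ∈ Set.Ioo a b, deriv (deriv U) x =
      t₃ * P x - (4 / 3) * P x * U x - 2 * t₂ * m x + 2 * t₁ * P x * m x
        - (2 / 3) * P x ^ 2 * m x - 12 * U x * m x ^ 2 - 16 * P x * m x ^ 3 := by
    intro x hx
    have h := hsysU x hx
    rw [iteratedDeriv_succ, iteratedDeriv_one, hUm x hx] at h
    have := hP'ne x hx
    rw [h]
    field_simp
  have hmP : ∀ x ∈ Set.Ioo a b, deriv m x * deriv P x = -24 * U x * m x ^ 2 := by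
    intro x hx
    have h := HasDerivAt.eq_of_eqOn_isOpen hI hx (g := m * deriv P) hUm
      (has _ (smooth_deriv U hU) x hx)
      ((has m hm x hx).mul (has _ (smooth_deriv P hP) x hx))
    rw [hU2 x hx, hP2 x hx] at h
    linear_combination P x / 3 * hS x hx - h
  have hzero : ∀ x ∈ Set.Ioo a b, deriv m x = 0 := by
    intro x₀ hx₀
    by_contra hne
    obtain ⟨V, hV_def⟩ : ∃ V : Set ℝ, V = Set.Ioo a b ∩ deriv m ⁻¹' {0}ᶜ := ⟨_, rfl⟩
    have hV : IsOpen V := by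
      rw [hV_def]
      exact hm'.continuousOn.isOpen_inter_preimage hI isOpen_compl_singleton
    have hx₀V : x₀ ∈ V := by
      rw [hV_def]
      exact ⟨hx₀, hne⟩
    have hVI : ∀ x ∈ V, x ∈ Set.Ioo a b := fun x hx => by
      rw [hV_def] at hx
      exact hx.1
    have hVne : ∀ x ∈ V, deriv m x ≠ 0 := fun x hx => by
      rw [hV_def] at hx
      exact hx.2
    have hPV : ∀ x ∈ V, P x = 3 / 2 * t₁ - 18 * m x ^ 2 := by
      intro x hx
      linear_combination
        1 / 4 * (mul_eq_zero.mp (hS' x (hVI x hx))).resolve_left (hVne x hx)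
    have hUV : ∀ x ∈ V, U x = 3 / 4 * t₃ - 12 * m x ^ 3 := by
      intro x hx
      linear_combination m x * hPV x hx - 1 / 4 * hS x (hVI x hx)
    have hP1V : ∀ x ∈ V, deriv P x = -36 * m x * deriv m x := by
      intro x hx
      have h := HasDerivAt.eq_of_eqOn_isOpen hV hx hPV (has P hP x (hVI x hx))
        ((((has m hm x (hVI x hx)).fun_pow 2).const_mul 18).const_sub (3 / 2 * t₁))
      rw [h]
      norm_num
      ring
    have hmne : ∀ x ∈ V, m x ≠ 0 := by
      intro x hx h0
      apply hP'ne x (hVI x hx)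
      rw [hP1V x hx, h0]
      ring
    have hm1V : ∀ x ∈ V, deriv m x ^ 2 = t₃ / 2 * m x - 8 * m x ^ 4 := by
      intro x hx
      have h := hmP x (hVI x hx)
      rw [hP1V x hx, hUV x hx] at h
      apply mul_left_cancel₀ (hmne x hx)
      linear_combination -1 / 36 * h
    have hm2V : ∀ x ∈ V, deriv (deriv m) x = t₃ / 4 - 16 * m x ^ 3 := by
      intro x hx
      have hmx := has m hm x (hVI x hx)
      have h := HasDerivAt.eq_of_eqOn_isOpen hV hx hm1V
        ((has _ hm' x (hVI x hx)).fun_pow 2)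
        ((hmx.const_mul (t₃ / 2)).fun_sub ((hmx.fun_pow 4).const_mul 8))
      norm_num at h
      apply mul_left_cancel₀ (hVne x hx)
      linear_combination 1 / 2 * h
    have hquartic : ∀ x ∈ V,
        1224 * m x ^ 4 - 36 * t₃ * m x = 3 / 2 * t₁ ^ 2 - 2 * t₂ := by
      intro x hx
      have hmx := has m hm x (hVI x hx)
      have h := HasDerivAt.eq_of_eqOn_isOpen hV hx hP1V
        (has _ (smooth_deriv P hP) x (hVI x hx))
        ((hmx.const_mul (-36)).fun_mul (has _ hm' x (hVI x hx)))
      rw [hP2 x (hVI x hx), hm2V x hx, hPV x hx, hUV x hx] at h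
      linear_combination 36 * hm1V x hx - h
    have hcubic : ∀ x ∈ V, m x ^ 3 = t₃ / 136 := by
      intro x hx
      have hmx := has m hm x (hVI x hx)
      have h := HasDerivAt.eq_of_eqOn_isOpen hV hx hquartic
        (((hmx.fun_pow 4).const_mul 1224).fun_sub (hmx.const_mul (36 * t₃)))
        (hasDerivAt_const x _)
      norm_num at h
      apply mul_left_cancel₀ (hVne x hx)
      linear_combination 1 / 4896 * h
    have h := HasDerivAt.eq_of_eqOn_isOpen hV hx₀V hcubic
      ((has m hm x₀ hx₀).fun_pow 3) (hasDerivAt_const x₀ _)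
    norm_num at h
    exact h.elim (hmne x₀ hx₀V) hne
  obtain ⟨c, hc⟩ := hI.exists_is_const_of_deriv_eq_zero isPreconnected_Ioo
    (hm.differentiableOn (by norm_num)) hzero
  refine ⟨c, fun x hx => ?_⟩
  rw [← hc x hx, hm_def]
end

section
/- The bracket {f, g} = Σᵢⱼ πᵢⱼ (∂f/∂xᵢ)(∂g/∂xⱼ) defined by the linear bivector π on ℝ⁴ satisfies the Jacobi identity: for all smooth functions f, g, h : ℝ⁴ → ℝ, {f, {g, h}} + {g, {h, f}} + {h, {f, g}} = 0 at every point of ℝ⁴. -/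
open scoped Matrix

/-- Partial derivative `∂f/∂xᵢ` of a function on ℝ⁴. -/
noncomputable def pd (f : (Fin 4 → ℝ) → ℝ) (x : Fin 4 → ℝ) (i : Fin 4) : ℝ :=
  fderiv ℝ f x (Pi.single i 1)

/-- The linear Poisson bivector of the genus-2 Novikov system, in coordinates
`x = (U, U₁, P, P₁)`. -/
noncomputable def Pmat (x : Fin 4 → ℝ) : Matrix (Fin 4) (Fin 4) ℝ :=
  !![0,        x 0 / 2, 0,        x 2;
     -x 0 / 2, 0,       -x 2,     -x 3 / 2;
     0,        x 2,     0,        0;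
     -x 2,     x 3 / 2, 0,        0]

/-- The bracket `{f, g} = Σᵢⱼ πᵢⱼ ∂ᵢf ∂ⱼg` of the linear bivector. -/
noncomputable def lbr (f g : (Fin 4 → ℝ) → ℝ) : (Fin 4 → ℝ) → ℝ :=
  fun x => ∑ i, ∑ j, Pmat x i j * pd f x i * pd g x j

theorem hasFDerivAt_pd {f : (Fin 4 → ℝ) → ℝ} (hf : ContDiff ℝ (⊤ : ℕ∞) f)
    (x : Fin 4 → ℝ) (i : Fin 4) :
    HasFDerivAt (fun y => pd f y i) ((fderiv ℝ (fderiv ℝ f) x).flip (Pi.single i 1)) x := by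
  have h : DifferentiableAt ℝ (fderiv ℝ f) x :=
    (hf.fderiv_right (m := 1) (by norm_cast)).differentiable (by norm_num) x
  simpa [pd] using h.hasFDerivAt.clm_apply (hasFDerivAt_const (Pi.single i (1 : ℝ)) x)

/-- Second partial derivatives of a smooth function commute. -/
theorem pd_pd_comm {f : (Fin 4 → ℝ) → ℝ} (hf : ContDiff ℝ (⊤ : ℕ∞) f)
    (x : Fin 4 → ℝ) (i k : Fin 4) :
    pd (fun y => pd f y i) x k = pd (fun y => pd f y k) x i := by
  rw [pd, pd, (hasFDerivAt_pd hf x i).fderiv, (hasFDerivAt_pd hf x k).fderiv]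
  exact (hf.contDiffAt.isSymmSndFDerivAt (by simp; norm_cast)) _ _

/-- The entries of `Pmat` are linear, hence are their own derivative. -/
theorem hasFDerivAt_Pmat (x : Fin 4 → ℝ) (i j : Fin 4) :
    ∃ L : (Fin 4 → ℝ) →L[ℝ] ℝ, (∀ y, L y = Pmat y i j) ∧ HasFDerivAt (fun y => Pmat y i j) L x := by
  have hadd (y z : Fin 4 → ℝ) : Pmat (y + z) i j = Pmat y i j + Pmat z i j := by
    fin_cases i <;> fin_cases j <;> simp [Pmat] <;> ring
  have hsmul (c : ℝ) (y : Fin 4 → ℝ) : Pmat (c • y) i j = c * Pmat y i j := by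
    fin_cases i <;> fin_cases j <;> simp [Pmat] <;> ring
  let L : (Fin 4 → ℝ) →ₗ[ℝ] ℝ :=
    { toFun := fun y => Pmat y i j, map_add' := hadd, map_smul' := hsmul }
  exact ⟨L.toContinuousLinearMap, fun _ => rfl, L.toContinuousLinearMap.hasFDerivAt⟩

/-- The Leibniz rule for the partial derivatives of a bracket. -/
theorem pd_lbr {g h : (Fin 4 → ℝ) → ℝ} (hg : ContDiff ℝ (⊤ : ℕ∞) g)
    (hh : ContDiff ℝ (⊤ : ℕ∞) h) (x : Fin 4 → ℝ) (k : Fin 4) :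
    pd (lbr g h) x k = ∑ i, ∑ j,
      (Pmat (Pi.single k 1) i j * pd g x i * pd h x j
        + Pmat x i j * pd (fun y => pd g y i) x k * pd h x j
        + Pmat x i j * pd g x i * pd (fun y => pd h y j) x k) := by
  choose L hL hLd using hasFDerivAt_Pmat x
  have key := HasFDerivAt.fun_sum (u := Finset.univ) fun i _ =>
    HasFDerivAt.fun_sum (u := Finset.univ) fun j _ =>
      ((hLd i j).fun_mul (hasFDerivAt_pd hg x i)).fun_mul (hasFDerivAt_pd hh x j)
  have hd : fderiv ℝ (lbr g h) x = _ := key.fderiv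
  rw [pd, hd]
  simp only [sum_apply, add_apply,
    smul_apply, smul_eq_mul, hL]
  refine Finset.sum_congr rfl fun i _ => Finset.sum_congr rfl fun j _ => ?_
  rw [pd.eq_1 (fun y => pd g y i), pd.eq_1 (fun y => pd h y j),
    (hasFDerivAt_pd hg x i).fderiv, (hasFDerivAt_pd hh x j).fderiv]
  ring

/-- The linear bracket on ℝ⁴ satisfies the Jacobi identity. -/
theorem stmt_8 (f g h : (Fin 4 → ℝ) → ℝ)
    (hf : ContDiff ℝ (⊤ : ℕ∞) f) (hg : ContDiff ℝ (⊤ : ℕ∞) g)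
    (hh : ContDiff ℝ (⊤ : ℕ∞) h) (x : Fin 4 → ℝ) :
    lbr f (lbr g h) x + lbr g (lbr h f) x + lbr h (lbr f g) x = 0 := by
  rw [lbr, lbr, lbr]
  simp only [pd_lbr hg hh, pd_lbr hh hf, pd_lbr hf hg]
  have symm {u : (Fin 4 → ℝ) → ℝ} (hu : ContDiff ℝ (⊤ : ℕ∞) u) :=
    (⟨pd_pd_comm hu x 1 0, pd_pd_comm hu x 2 0, pd_pd_comm hu x 3 0,
      pd_pd_comm hu x 2 1, pd_pd_comm hu x 3 1, pd_pd_comm hu x 3 2⟩ : _ ∧ _ ∧ _ ∧ _ ∧ _ ∧ _)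
  simp [Fin.sum_univ_four, Pmat, symm hf, symm hg, symm hh]
  ring
end

section
/- On the open set {P > 0} ⊂ ℝ⁴, define q₁ = √P, q₂ = U/√P, p₁ = 2U₁/√P, p₂ = P₁/√P. Then with respect to the bracket {f, g} = Σᵢⱼ πᵢⱼ ∂ᵢf ∂ⱼg of the linear bivector π, these functions are Darboux coordinates: {q₁, p₁} = 1, {q₂, p₂} = 1, and {q₁, q₂} = {p₁, p₂} = {q₁, p₂} = {q₂, p₁} = 0 at every point with P > 0. -/
open scoped Matrix

theorem pd_sqrt {x : Fin 4 → ℝ} {k : Fin 4} (hx : 0 < x k) (i : Fin 4) :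
    pd (fun y => Real.sqrt (y k)) x i =
      (Pi.single i 1 : Fin 4 → ℝ) k / (2 * Real.sqrt (x k)) := by
  have h := (hasFDerivAt_apply (𝕜 := ℝ) k x).sqrt hx.ne'
  rw [pd, h.fderiv]
  simp [div_eq_inv_mul]

theorem pd_const_mul_div_sqrt {x : Fin 4 → ℝ} {k : Fin 4} (hx : 0 < x k) (c : ℝ)
    (j i : Fin 4) :
    pd (fun y => c * y j / Real.sqrt (y k)) x i =
      c * (Pi.single i 1 : Fin 4 → ℝ) j / Real.sqrt (x k)
        - c * x j * (Pi.single i 1 : Fin 4 → ℝ) k / (2 * Real.sqrt (x k) ^ 3) := by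
  have hs : Real.sqrt (x k) ≠ 0 := (Real.sqrt_pos.2 hx).ne'
  have h := ((hasFDerivAt_apply (𝕜 := ℝ) j x).const_mul c).mul
    ((hasDerivAt_inv hs).comp_hasFDerivAt x
      ((hasFDerivAt_apply (𝕜 := ℝ) k x).sqrt hx.ne'))
  have h_quot : (fun y : Fin 4 → ℝ => c * y j / Real.sqrt (y k)) =
      (fun y => c * y j) * ((fun r : ℝ => r⁻¹) ∘ fun y => Real.sqrt (y k)) := by
    ext y
    simp [div_eq_mul_inv]
  rw [pd, h_quot, h.fderiv]
  simp
  field_simp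
  ring

theorem pd_div_sqrt {x : Fin 4 → ℝ} {k : Fin 4} (hx : 0 < x k) (j i : Fin 4) :
    pd (fun y => y j / Real.sqrt (y k)) x i =
      (Pi.single i 1 : Fin 4 → ℝ) j / Real.sqrt (x k)
        - x j * (Pi.single i 1 : Fin 4 → ℝ) k / (2 * Real.sqrt (x k) ^ 3) := by
  simpa using pd_const_mul_div_sqrt hx 1 j i

/-- On the open set `{P > 0} ⊂ ℝ⁴` (coordinates `x = (U, U₁, P, P₁)`), the
functions `q₁ = √P`, `q₂ = U/√P`, `p₁ = 2U₁/√P`, `p₂ = P₁/√P` are Darboux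
coordinates for the linear bracket. -/
theorem stmt_11 (x : Fin 4 → ℝ) (hx : 0 < x 2) :
    let q₁ : (Fin 4 → ℝ) → ℝ := fun y => Real.sqrt (y 2)
    let q₂ : (Fin 4 → ℝ) → ℝ := fun y => y 0 / Real.sqrt (y 2)
    let p₁ : (Fin 4 → ℝ) → ℝ := fun y => 2 * y 1 / Real.sqrt (y 2)
    let p₂ : (Fin 4 → ℝ) → ℝ := fun y => y 3 / Real.sqrt (y 2)
    lbr q₁ p₁ x = 1 ∧ lbr q₂ p₂ x = 1 ∧ lbr q₁ q₂ x = 0 ∧ lbr p₁ p₂ x = 0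
      ∧ lbr q₁ p₂ x = 0 ∧ lbr q₂ p₁ x = 0 := by
  obtain ⟨s, hs, hsx⟩ : ∃ s, 0 < s ∧ Real.sqrt (x 2) = s :=
    ⟨_, Real.sqrt_pos.2 hx, rfl⟩
  have hx2 : x 2 = s ^ 2 := by rw [← hsx, Real.sq_sqrt hx.le]
  refine ⟨?_, ?_, ?_, ?_, ?_, ?_⟩ <;>
  · simp only [lbr, pd_sqrt hx, pd_const_mul_div_sqrt hx, pd_div_sqrt hx, hsx]
    simp [Fin.sum_univ_four, Pmat, Pi.single_apply, hx2]
    try field_simp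
    try ring
end

section
/- Let t₁, t₂, t₃ ∈ ℝ. On the open set {q₁ ≠ 0} ⊂ ℝ⁴ with coordinates (q₁, q₂, p₁, p₂), the functions H₁ and H₂ are in involution with respect to the canonical Poisson bracket: (∂H₁/∂q₁)(∂H₂/∂p₁) + (∂H₁/∂q₂)(∂H₂/∂p₂) − (∂H₁/∂p₁)(∂H₂/∂q₁) − (∂H₁/∂p₂)(∂H₂/∂q₂) = 0 at every point with q₁ ≠ 0. -/
/-- The canonical Poisson bracket on ℝ⁴ with coordinates
`x = (q₁, q₂, p₁, p₂)`: `{f,g} = Σᵢ (∂f/∂qᵢ ∂g/∂pᵢ − ∂f/∂pᵢ ∂g/∂qᵢ)`. -/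
noncomputable def cbr (f g : (Fin 4 → ℝ) → ℝ) : (Fin 4 → ℝ) → ℝ :=
  fun x => pd f x 0 * pd g x 2 + pd f x 1 * pd g x 3
    - pd f x 2 * pd g x 0 - pd f x 3 * pd g x 1

/-- The Hamiltonian `H₁` in the coordinates `x = (q₁, q₂, p₁, p₂)`. -/
noncomputable def H1q (t₁ t₂ t₃ : ℝ) (x : Fin 4 → ℝ) : ℝ :=
  (1 / 2) * x 2 * x 3 - (x 1 / (4 * x 0)) * (x 3) ^ 2 + (x 0) ^ 3 * x 1
    + (x 1) ^ 3 / x 0 - t₁ * x 0 * x 1 - t₂ * x 1 / x 0 - t₃ * (x 0) ^ 2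

/-- The integral `H₂` in the coordinates `x = (q₁, q₂, p₁, p₂)`. -/
noncomputable def H2q (t₁ t₂ t₃ : ℝ) (x : Fin 4 → ℝ) : ℝ :=
  ((1 / (8 * x 0)) * (x 3) ^ 2
      + (3 * t₂ - 3 * t₁ * (x 0) ^ 2 + (x 0) ^ 4 - 3 * (x 1) ^ 2) / (6 * x 0)) ^ 2
    + (t₁ * t₂ / 2 - (1 / 4) * (x 2) ^ 2 + 2 * t₃ * x 0 * x 1
      - (4 / 3) * (x 0) ^ 2 * (x 1) ^ 2)

/-- The quotient rule for real-valued functions on a normed space. -/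
theorem hasFDerivAt_div {E : Type*} [NormedAddCommGroup E] [NormedSpace ℝ E] {f g : E → ℝ}
    {f' g' : E →L[ℝ] ℝ} {x : E} (hf : HasFDerivAt f f' x) (hg : HasFDerivAt g g' x)
    (hx : g x ≠ 0) :
    HasFDerivAt (fun y => f y / g y) (f x • (-(g x ^ 2)⁻¹ • g') + (g x)⁻¹ • f') x := by
  simp only [div_eq_mul_inv]
  exact hf.fun_mul ((hasDerivAt_inv hx).comp_hasFDerivAt x hg)

/-- The differential of `H₁` in coordinates. -/
theorem fderiv_H1q_apply (t₁ t₂ t₃ : ℝ) {x : Fin 4 → ℝ} (hx : x 0 ≠ 0) (v : Fin 4 → ℝ) :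
    fderiv ℝ (H1q t₁ t₂ t₃) x v =
      (x 1 * x 3 ^ 2 / (4 * x 0 ^ 2) + 3 * x 0 ^ 2 * x 1 - x 1 ^ 3 / x 0 ^ 2 - t₁ * x 1
          + t₂ * x 1 / x 0 ^ 2 - 2 * t₃ * x 0) * v 0
        + (-x 3 ^ 2 / (4 * x 0) + x 0 ^ 3 + 3 * x 1 ^ 2 / x 0 - t₁ * x 0 - t₂ / x 0) * v 1
        + x 3 / 2 * v 2
        + (x 2 / 2 - x 1 * x 3 / (2 * x 0)) * v 3 := by
  have h (i : Fin 4) := hasFDerivAt_apply (𝕜 := ℝ) i x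
  have h4 : 4 * x 0 ≠ 0 := mul_ne_zero (by norm_num) hx
  have H := (((((((h 2).const_mul (1 / 2)).fun_mul (h 3)).fun_sub
    ((hasFDerivAt_div (h 1) ((h 0).const_mul 4) h4).fun_mul ((h 3).pow 2))).fun_add
    (((h 0).pow 3).fun_mul (h 1))).fun_add
    (hasFDerivAt_div ((h 1).pow 3) (h 0) hx)).fun_sub
    (((h 0).const_mul t₁).fun_mul (h 1))).fun_sub
    (hasFDerivAt_div ((h 1).const_mul t₂) (h 0) hx) |>.fun_sub
    (((h 0).pow 2).const_mul t₃)
  rw [show fderiv ℝ (H1q t₁ t₂ t₃) x = _ from H.fderiv]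
  simp
  field_simp
  ring

/-- The differential of `H₂` in coordinates. -/
theorem fderiv_H2q_apply (t₁ t₂ t₃ : ℝ) {x : Fin 4 → ℝ} (hx : x 0 ≠ 0) (v : Fin 4 → ℝ) :
    fderiv ℝ (H2q t₁ t₂ t₃) x v =
      (2 * (x 3 ^ 2 / 8 + (3 * t₂ - 3 * t₁ * x 0 ^ 2 + x 0 ^ 4 - 3 * x 1 ^ 2) / 6)
          * ((2 * x 0 ^ 2 / 3 - t₁) / x 0
            - (x 3 ^ 2 / 8 + (3 * t₂ - 3 * t₁ * x 0 ^ 2 + x 0 ^ 4 - 3 * x 1 ^ 2) / 6) / x 0 ^ 3)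
          + 2 * t₃ * x 1 - 8 / 3 * x 0 * x 1 ^ 2) * v 0
        + (-2 * (x 3 ^ 2 / 8 + (3 * t₂ - 3 * t₁ * x 0 ^ 2 + x 0 ^ 4 - 3 * x 1 ^ 2) / 6)
            * x 1 / x 0 ^ 2
          + 2 * t₃ * x 0 - 8 / 3 * x 0 ^ 2 * x 1) * v 1
        - x 2 / 2 * v 2
        + (x 3 ^ 2 / 8 + (3 * t₂ - 3 * t₁ * x 0 ^ 2 + x 0 ^ 4 - 3 * x 1 ^ 2) / 6) * x 3
          / (2 * x 0 ^ 2) * v 3 := by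
  have h (i : Fin 4) := hasFDerivAt_apply (𝕜 := ℝ) i x
  have h6 : 6 * x 0 ≠ 0 := mul_ne_zero (by norm_num) hx
  have h8 : 8 * x 0 ≠ 0 := mul_ne_zero (by norm_num) hx
  have hA := (hasFDerivAt_div (hasFDerivAt_const (1 : ℝ) x) ((h 0).const_mul 8) h8).fun_mul
    ((h 3).pow 2)
  have hB := hasFDerivAt_div ((((((h 0).pow 2).const_mul (3 * t₁)).const_sub (3 * t₂)).fun_add
    ((h 0).pow 4)).fun_sub (((h 1).pow 2).const_mul 3))
    ((h 0).const_mul 6) h6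
  have hC := (((((h 2).pow 2).const_mul (1 / 4)).const_sub (t₁ * t₂ / 2)).fun_add
    (((h 0).const_mul (2 * t₃)).fun_mul (h 1))).fun_sub
    ((((h 0).pow 2).const_mul (4 / 3)).fun_mul ((h 1).pow 2))
  have H := ((hA.fun_add hB).pow 2).fun_add hC
  rw [show fderiv ℝ (H2q t₁ t₂ t₃) x = _ from H.fderiv]
  simp
  field_simp
  ring

/-- `H₁` and `H₂` are in involution with respect to the canonical Poisson
bracket on the open set `{q₁ ≠ 0}`. -/
theorem stmt_13 (t₁ t₂ t₃ : ℝ) (x : Fin 4 → ℝ) (hx : x 0 ≠ 0) :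
    cbr (H1q t₁ t₂ t₃) (H2q t₁ t₂ t₃) x = 0 := by
  simp only [cbr, pd, fderiv_H1q_apply t₁ t₂ t₃ hx, fderiv_H2q_apply t₁ t₂ t₃ hx]
  simp
  field_simp
  ring
end

section
/- Let t₁, t₂, t₃ ∈ ℝ. On the open set {q₁ ≠ 0} ⊂ ℝ⁴, the functions H₁ and H₂ are in involution with respect to the second bracket: {H₁, H₂}' = Σᵢⱼ π'ᵢⱼ ∂ᵢH₁ ∂ⱼH₂ = 0 at every point with q₁ ≠ 0. -/
open scoped Matrix

/-- The second (quadratic in momenta) bivector `π'` on `{q₁ ≠ 0}`, coordinates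
`x = (q₁, q₂, p₁, p₂)`. -/
noncomputable def P'mat (t₁ t₂ : ℝ) (x : Fin 4 → ℝ) : Matrix (Fin 4) (Fin 4) ℝ :=
  let a : ℝ := x 3 / (2 * x 0)
  let b : ℝ := x 2 / (2 * x 0) - (x 0) ^ 2 / 6 + t₁ / 2
    - ((x 3) ^ 2 / 4 + x 1 * x 3 - (x 1) ^ 2 + t₂) / (2 * (x 0) ^ 2)
  let c : ℝ := -(x 1) / x 0
  let d : ℝ := (x 0) ^ 2 - t₁ - ((x 3) ^ 2 / 4 - 3 * (x 1) ^ 2 + t₂) / (x 0) ^ 2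
  !![0,  0,  a,  1;
     0,  0,  b,  c;
     -a, -b, 0,  d;
     -1, -c, -d, 0]

/-- If `f` is differentiable, its partial derivatives are its derivatives along coordinate lines. -/
theorem pd_eq_of_hasLineDerivAt {f : (Fin 4 → ℝ) → ℝ} {x : Fin 4 → ℝ} {i : Fin 4} {c : ℝ}
    (hf : DifferentiableAt ℝ f x) (h : HasLineDerivAt ℝ f c x (Pi.single i 1)) :
    pd f x i = c := by
  rw [pd, ← hf.lineDeriv_eq_fderiv, h.lineDeriv]

theorem hasDerivAt_line_coord (x v : Fin 4 → ℝ) (j : Fin 4) :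
    HasDerivAt (fun s : ℝ => (x + s • v) j) (v j) 0 := by
  simpa using ((hasDerivAt_id (0 : ℝ)).mul_const (v j)).const_add (x j)

theorem differentiableAt_H1q (t₁ t₂ t₃ : ℝ) {x : Fin 4 → ℝ} (hx : x 0 ≠ 0) :
    DifferentiableAt ℝ (H1q t₁ t₂ t₃) x := by
  have h4 : 4 * x 0 ≠ 0 := mul_ne_zero (by norm_num) hx
  unfold H1q
  fun_prop (disch := assumption)

theorem differentiableAt_H2q (t₁ t₂ t₃ : ℝ) {x : Fin 4 → ℝ} (hx : x 0 ≠ 0) :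
    DifferentiableAt ℝ (H2q t₁ t₂ t₃) x := by
  have h6 : 6 * x 0 ≠ 0 := mul_ne_zero (by norm_num) hx
  have h8 : 8 * x 0 ≠ 0 := mul_ne_zero (by norm_num) hx
  unfold H2q
  fun_prop (disch := assumption)

theorem hasLineDerivAt_H1q (t₁ t₂ t₃ : ℝ) {x : Fin 4 → ℝ} (hx : x 0 ≠ 0) (v : Fin 4 → ℝ) :
    HasLineDerivAt ℝ (H1q t₁ t₂ t₃)
      (((x 1 * x 3 ^ 2 / 4 - x 1 ^ 3 + t₂ * x 1) / x 0 ^ 2 + 3 * x 0 ^ 2 * x 1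
          - t₁ * x 1 - 2 * t₃ * x 0) * v 0
        + (-x 3 ^ 2 / (4 * x 0) + x 0 ^ 3 + 3 * x 1 ^ 2 / x 0 - t₁ * x 0 - t₂ / x 0) * v 1
        + x 3 / 2 * v 2 + (x 2 / 2 - x 1 * x 3 / (2 * x 0)) * v 3) x v := by
  have h0 := hasDerivAt_line_coord x v 0
  have h1 := hasDerivAt_line_coord x v 1
  have h2 := hasDerivAt_line_coord x v 2
  have h3 := hasDerivAt_line_coord x v 3
  have hx' : (x + (0 : ℝ) • v) 0 ≠ 0 := by simpa using hx
  have h4 : 4 * (x + (0 : ℝ) • v) 0 ≠ 0 := mul_ne_zero (by norm_num) hx'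
  have h := (((((((h2.const_mul (1 / 2)).mul h3).sub
    ((h1.div (h0.const_mul 4) h4).mul (h3.pow 2))).add ((h0.pow 3).mul h1)).add
    ((h1.pow 3).div h0 hx')).sub ((h0.const_mul t₁).mul h1)).sub
    ((h1.const_mul t₂).div h0 hx')).sub ((h0.pow 2).const_mul t₃)
  refine HasDerivAt.congr_deriv h ?_
  simp
  field_simp
  ring

theorem hasLineDerivAt_H2q (t₁ t₂ t₃ : ℝ) {x : Fin 4 → ℝ} (hx : x 0 ≠ 0) (v : Fin 4 → ℝ) :
    HasLineDerivAt ℝ (H2q t₁ t₂ t₃)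
      (2 * (x 3 ^ 2 / (8 * x 0)
            + (3 * t₂ - 3 * t₁ * x 0 ^ 2 + x 0 ^ 4 - 3 * x 1 ^ 2) / (6 * x 0))
          * ((-x 3 ^ 2 / (8 * x 0 ^ 2) + (x 1 ^ 2 - t₂) / (2 * x 0 ^ 2) - t₁ / 2
              + x 0 ^ 2 / 2) * v 0
            - x 1 / x 0 * v 1 + x 3 / (4 * x 0) * v 3)
        + (2 * t₃ * x 1 - 8 / 3 * x 0 * x 1 ^ 2) * v 0
        + (2 * t₃ * x 0 - 8 / 3 * x 0 ^ 2 * x 1) * v 1 - x 2 / 2 * v 2) x v := by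
  have h0 := hasDerivAt_line_coord x v 0
  have h1 := hasDerivAt_line_coord x v 1
  have h2 := hasDerivAt_line_coord x v 2
  have h3 := hasDerivAt_line_coord x v 3
  have hx' : (x + (0 : ℝ) • v) 0 ≠ 0 := by simpa using hx
  have h6 : 6 * (x + (0 : ℝ) • v) 0 ≠ 0 := mul_ne_zero (by norm_num) hx'
  have h8 : 8 * (x + (0 : ℝ) • v) 0 ≠ 0 := mul_ne_zero (by norm_num) hx'
  have h := (((((hasDerivAt_const (0 : ℝ) (1 : ℝ)).div (h0.const_mul 8) h8).mul (h3.pow 2)).add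
    ((((((h0.pow 2).const_mul (3 * t₁)).const_sub (3 * t₂)).add (h0.pow 4)).sub
      ((h1.pow 2).const_mul 3)).div (h0.const_mul 6) h6)).pow 2).add
    (((((h2.pow 2).const_mul (1 / 4)).const_sub (t₁ * t₂ / 2)).add
      ((h0.const_mul (2 * t₃)).mul h1)).sub (((h0.pow 2).const_mul (4 / 3)).mul (h1.pow 2)))
  refine HasDerivAt.congr_deriv h ?_
  simp
  field_simp
  ring

/-- `H₁` and `H₂` are in involution with respect to the second bracket `{,}'`
on the open set `{q₁ ≠ 0}`. -/
theorem stmt_15 (t₁ t₂ t₃ : ℝ) (x : Fin 4 → ℝ) (hx : x 0 ≠ 0) :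
    ∑ i, ∑ j, P'mat t₁ t₂ x i j * pd (H1q t₁ t₂ t₃) x i * pd (H2q t₁ t₂ t₃) x j
      = 0 := by
  have e1 (i : Fin 4) := pd_eq_of_hasLineDerivAt (differentiableAt_H1q t₁ t₂ t₃ hx)
    (hasLineDerivAt_H1q t₁ t₂ t₃ hx (Pi.single i 1))
  have e2 (i : Fin 4) := pd_eq_of_hasLineDerivAt (differentiableAt_H2q t₁ t₂ t₃ hx)
    (hasLineDerivAt_H2q t₁ t₂ t₃ hx (Pi.single i 1))
  simp only [e1, e2, Fin.sum_univ_four]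
  simp [P'mat]
  field_simp
  ring
end

section
/- Let t₁, t₂ ∈ ℝ. On the open set {q₁ ≠ 0} ⊂ ℝ⁴ define, for each scalar z ∈ ℝ, the functions B(z) = z² − ((p₂ − 2q₂)/(2q₁))z + q₁²/6 − t₁/2 − p₁/(2q₁) + (p₂²/4 − q₂² + t₂)/(2q₁²) and A(z) = q₁²z + 2q₁q₂. Then for all scalars z ≠ w, the canonical Poisson bracket satisfies {B(z), A(w)} = (B(z) − B(w))/(z − w) and {A(z), A(w)} = 0 at every point with q₁ ≠ 0. -/
/-- `B(z)`: the characteristic polynomial of the recursion operator, as a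
function on `{q₁ ≠ 0} ⊂ ℝ⁴`, `x = (q₁, q₂, p₁, p₂)`. -/
noncomputable def Bfun (t₁ t₂ z : ℝ) (x : Fin 4 → ℝ) : ℝ :=
  z ^ 2 - ((x 3 - 2 * x 1) / (2 * x 0)) * z + (x 0) ^ 2 / 6 - t₁ / 2
    - x 2 / (2 * x 0) + ((x 3) ^ 2 / 4 - (x 1) ^ 2 + t₂) / (2 * (x 0) ^ 2)

/-- `A(z)`: the conjugate polynomial defining the variables of separation. -/
noncomputable def Afun (z : ℝ) (x : Fin 4 → ℝ) : ℝ :=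
  (x 0) ^ 2 * z + 2 * x 0 * x 1

/-- If `f` is quadratic along the `i`-th coordinate line through `x`, then its partial derivative
is the linear coefficient. -/
theorem pd_eq_of_quadratic {f : (Fin 4 → ℝ) → ℝ} {x : Fin 4 → ℝ} {i : Fin 4} {c : ℝ} (b : ℝ)
    (hf : DifferentiableAt ℝ f x)
    (h : ∀ t : ℝ, f (x + t • Pi.single i 1) = f x + t * c + t ^ 2 * b) : pd f x i = c := by
  rw [pd, ← hf.lineDeriv_eq_fderiv, lineDeriv, funext h]
  have h₁ := ((hasDerivAt_id' (0 : ℝ)).mul_const c).const_add (f x)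
  have h₂ := (hasDerivAt_pow 2 (0 : ℝ)).mul_const b
  simpa using (h₁.fun_add h₂).deriv

theorem differentiableAt_Afun (z : ℝ) (x : Fin 4 → ℝ) : DifferentiableAt ℝ (Afun z) x := by
  unfold Afun
  fun_prop

theorem differentiableAt_Bfun (t₁ t₂ z : ℝ) {x : Fin 4 → ℝ} (hx : x 0 ≠ 0) :
    DifferentiableAt ℝ (Bfun t₁ t₂ z) x := by
  have h₁ : 2 * x 0 ≠ 0 := by positivity
  have h₂ : 2 * x 0 ^ 2 ≠ 0 := by positivity
  unfold Bfun
  fun_prop (disch := assumption)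

theorem pd_Afun_q₁ (z : ℝ) (x : Fin 4 → ℝ) : pd (Afun z) x 0 = 2 * x 0 * z + 2 * x 1 := by
  refine pd_eq_of_quadratic z (differentiableAt_Afun z x) fun t => ?_
  simp [Afun]
  ring

theorem pd_Afun_q₂ (z : ℝ) (x : Fin 4 → ℝ) : pd (Afun z) x 1 = 2 * x 0 := by
  refine pd_eq_of_quadratic 0 (differentiableAt_Afun z x) fun t => ?_
  simp [Afun]
  ring

theorem pd_Afun_p₁ (z : ℝ) (x : Fin 4 → ℝ) : pd (Afun z) x 2 = 0 := by
  refine pd_eq_of_quadratic 0 (differentiableAt_Afun z x) fun t => ?_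
  simp [Afun]

theorem pd_Afun_p₂ (z : ℝ) (x : Fin 4 → ℝ) : pd (Afun z) x 3 = 0 := by
  refine pd_eq_of_quadratic 0 (differentiableAt_Afun z x) fun t => ?_
  simp [Afun]

theorem pd_Bfun_p₁ (t₁ t₂ z : ℝ) {x : Fin 4 → ℝ} (hx : x 0 ≠ 0) :
    pd (Bfun t₁ t₂ z) x 2 = -(1 / (2 * x 0)) := by
  refine pd_eq_of_quadratic 0 (differentiableAt_Bfun t₁ t₂ z hx) fun t => ?_
  simp [Bfun]
  ring

theorem pd_Bfun_p₂ (t₁ t₂ z : ℝ) {x : Fin 4 → ℝ} (hx : x 0 ≠ 0) :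
    pd (Bfun t₁ t₂ z) x 3 = -(z / (2 * x 0)) + x 3 / (4 * x 0 ^ 2) := by
  refine pd_eq_of_quadratic (1 / (8 * x 0 ^ 2)) (differentiableAt_Bfun t₁ t₂ z hx) fun t => ?_
  simp [Bfun]
  ring

/-- The separation relations `{B(z), A(w)} = (B(z) − B(w))/(z − w)` and
`{A(z), A(w)} = 0` for the canonical Poisson bracket on `{q₁ ≠ 0}`. -/
theorem stmt_16 (t₁ t₂ : ℝ) (z w : ℝ) (hzw : z ≠ w)
    (x : Fin 4 → ℝ) (hx : x 0 ≠ 0) :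
    cbr (Bfun t₁ t₂ z) (Afun w) x = (Bfun t₁ t₂ z x - Bfun t₁ t₂ w x) / (z - w)
      ∧ cbr (Afun z) (Afun w) x = 0 := by
  have hzw' : z - w ≠ 0 := sub_ne_zero.mpr hzw
  constructor
  · simp only [cbr, pd_Afun_q₁, pd_Afun_q₂, pd_Afun_p₁, pd_Afun_p₂, pd_Bfun_p₁ t₁ t₂ z hx,
      pd_Bfun_p₂ t₁ t₂ z hx, Bfun]
    field_simp
    ring
  · simp [cbr, pd_Afun_p₁, pd_Afun_p₂]
end

section
/- Let z₁, z₂, z₃, z₄, z₅ ∈ ℂ. (i) If ξ, η ∈ ℂ satisfy η² = ξ⁶ − 2ξ⁴z₁ − 2ξ³z₂ + ξ²(z₁² − 4z₃) + ξ(2z₁z₂ − 4z₄) + (z₂² − 4z₅), then λ = (1/2)(η + ξ³ − ξz₁ − z₂) and μ = (1/2)ξ(η + ξ³ − ξz₁ − z₂) satisfy μ³ = λ⁴ + z₁λ²μ + z₂λ³ + z₃μ² + z₄λμ + z₅λ². (ii) Conversely, if λ, μ ∈ ℂ with λ ≠ 0 satisfy μ³ = λ⁴ + z₁λ²μ + z₂λ³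 + z₃μ² + z₄λμ + z₅λ², then ξ = μ/λ and η = −μ³/λ³ + 2λ + μz₁/λ + z₂ satisfy η² = ξ⁶ − 2ξ⁴z₁ − 2ξ³z₂ + ξ²(z₁² − 4z₃) + ξ(2z₁z₂ − 4z₄) + (z₂² − 4z₅), and moreover (1/2)(η + ξ³ − ξz₁ − z₂) = λ and (1/2)ξ(η + ξ³ − ξz₁ − z₂) = μ. -/
/-- The birational map between the trigonal-type plane curve
`μ³ = λ⁴ + z₁λ²μ + z₂λ³ + z₃μ² + z₄λμ + z₅λ²` and its hyperelliptic form
`η² = ξ⁶ − 2ξ⁴z₁ − 2ξ³z₂ + ξ²(z₁² − 4z₃) + ξ(2z₁z₂ − 4z₄) + (z₂² − 4z₅)`. -/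
theorem stmt_18 (z₁ z₂ z₃ z₄ z₅ : ℂ) :
    (∀ ξ η : ℂ,
      η ^ 2 = ξ ^ 6 - 2 * ξ ^ 4 * z₁ - 2 * ξ ^ 3 * z₂ + ξ ^ 2 * (z₁ ^ 2 - 4 * z₃)
          + ξ * (2 * z₁ * z₂ - 4 * z₄) + (z₂ ^ 2 - 4 * z₅) →
      ((1 / 2) * (η + ξ ^ 3 - ξ * z₁ - z₂)) ^ 4
          + z₁ * ((1 / 2) * (η + ξ ^ 3 - ξ * z₁ - z₂)) ^ 2
              * ((1 / 2) * ξ * (η + ξ ^ 3 - ξ * z₁ - z₂))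
          + z₂ * ((1 / 2) * (η + ξ ^ 3 - ξ * z₁ - z₂)) ^ 3
          + z₃ * ((1 / 2) * ξ * (η + ξ ^ 3 - ξ * z₁ - z₂)) ^ 2
          + z₄ * ((1 / 2) * (η + ξ ^ 3 - ξ * z₁ - z₂))
              * ((1 / 2) * ξ * (η + ξ ^ 3 - ξ * z₁ - z₂))
          + z₅ * ((1 / 2) * (η + ξ ^ 3 - ξ * z₁ - z₂)) ^ 2
        = ((1 / 2) * ξ * (η + ξ ^ 3 - ξ * z₁ - z₂)) ^ 3)
    ∧
    (∀ lam mu : ℂ, lam ≠ 0 →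
      mu ^ 3 = lam ^ 4 + z₁ * lam ^ 2 * mu + z₂ * lam ^ 3 + z₃ * mu ^ 2
          + z₄ * lam * mu + z₅ * lam ^ 2 →
      ((- mu ^ 3 / lam ^ 3 + 2 * lam + mu * z₁ / lam + z₂) ^ 2
          = (mu / lam) ^ 6 - 2 * (mu / lam) ^ 4 * z₁ - 2 * (mu / lam) ^ 3 * z₂
            + (mu / lam) ^ 2 * (z₁ ^ 2 - 4 * z₃)
            + (mu / lam) * (2 * z₁ * z₂ - 4 * z₄) + (z₂ ^ 2 - 4 * z₅))
        ∧ (1 / 2) * ((- mu ^ 3 / lam ^ 3 + 2 * lam + mu * z₁ / lam + z₂)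
              + (mu / lam) ^ 3 - (mu / lam) * z₁ - z₂) = lam
        ∧ (1 / 2) * (mu / lam) * ((- mu ^ 3 / lam ^ 3 + 2 * lam + mu * z₁ / lam + z₂)
              + (mu / lam) ^ 3 - (mu / lam) * z₁ - z₂) = mu) := by
  refine ⟨fun ξ η h => ?_, fun lam mu hlam h => ?_⟩
  · linear_combination ((1 / 2) * (η + ξ ^ 3 - ξ * z₁ - z₂)) ^ 2 * (1 / 4) * h
  · obtain ⟨ξ, rfl⟩ : ∃ ξ, mu = ξ * lam := ⟨mu / lam, (div_mul_cancel₀ mu hlam).symm⟩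
    have hξ : ξ * lam / lam = ξ := mul_div_cancel_right₀ ξ hlam
    have hη : -(ξ * lam) ^ 3 / lam ^ 3 + 2 * lam + ξ * lam * z₁ / lam + z₂
        = 2 * lam - (ξ ^ 3 - ξ * z₁ - z₂) := by
      field_simp
      ring
    have hquad : lam ^ 2 - lam * (ξ ^ 3 - ξ * z₁ - z₂) + (z₃ * ξ ^ 2 + z₄ * ξ + z₅) = 0 := by
      apply mul_left_cancel₀ (pow_ne_zero 2 hlam)
      linear_combination -h
    rw [hξ, hη]
    refine ⟨?_, ?_, ?_⟩
    · linear_combination 4 * hquad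
    · ring
    · ring
end
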